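/- Assume additionally p > 0. For all integers k, k' with 1 ≤ k ≤ k' ≤ n it holds that app(k) ≤ (1 + M̃·(n−k)/(k+1))·opt(k'), where M̃ := (M_∞/m_∞)·(p̄/p). -/

import Mathlib

open scoped BigOperators

/-- Dot product of two vectors in `ℝ^ν`. -/
noncomputable def dot {ν : ℕ} (c x : Fin ν → ℝ) : ℝ := ∑ j, c j * x j

/-- `convComb X k` is the set `X(k)` of all convex combinations of at most `k` points of `X`. -/
def convComb {ν : ℕ} (X : Set (Fin ν → ℝ)) (k : ℕ) : Set (Fin ν → ℝ) :=
  { x | ∃ (xs : Fin k → (Fin ν → ℝ)) (lam : Fin k → ℝ),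
      (∀ i, xs i ∈ X) ∧ (∀ i, 0 ≤ lam i) ∧ (∑ i, lam i) = 1 ∧
      x = ∑ i, lam i • xs i }

/-- The worst-case objective `max_{c ∈ U} cᵀx`. -/
noncomputable def objSup {ν : ℕ} (U : Set (Fin ν → ℝ)) (x : Fin ν → ℝ) : ℝ :=
  sSup ((fun c => dot c x) '' U)

/-- `opt(k) = min_{x ∈ X(k)} max_{c ∈ U} cᵀx`. -/
noncomputable def optVal {ν : ℕ} (X U : Set (Fin ν → ℝ)) (k : ℕ) : ℝ :=
  sInf (objSup U '' convComb X k)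

/-- `‖x‖₀`, the number of nonzero entries of `x`, as a real number. -/
noncomputable def zeroNorm {ν : ℕ} (x : Fin ν → ℝ) : ℝ :=
  ((Finset.univ.filter (fun j => x j ≠ 0)).card : ℝ)

/-- The min-max-min robust value over `k`-tuples of feasible solutions:
`min_{x¹,…,x^k ∈ X} max_{c ∈ U} min_{i} cᵀxⁱ`. -/
noncomputable def minmaxVal {ν : ℕ} (X U : Set (Fin ν → ℝ)) (k : ℕ) : ℝ :=
  sInf { v : ℝ | ∃ xs : Fin k → (Fin ν → ℝ), (∀ i, xs i ∈ X) ∧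
    v = sSup ((fun c => ⨅ i, dot c (xs i)) '' U) }

/-- `app(k)`, the objective value of the `k` solutions `x¹,…,x^k` with largest weights
returned by Algorithm 1: `max_{c ∈ U} min_{i=1,…,k} cᵀxⁱ`. -/
noncomputable def appVal {ν : ℕ} (U : Set (Fin ν → ℝ)) (xs : Fin ν → (Fin ν → ℝ)) (k : ℕ) : ℝ :=
  sSup ((fun c => ⨅ i : {i : Fin ν // (i : ℕ) < k}, dot c (xs i.1)) '' U)

theorem dot_sum_smul {ν : ℕ} {ι : Type*} [Fintype ι] (c : Fin ν → ℝ) (lam : ι → ℝ)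
    (xs : ι → (Fin ν → ℝ)) : dot c (∑ i, lam i • xs i) = ∑ i, lam i * dot c (xs i) := by
  simp only [dot, Finset.sum_apply, Pi.smul_apply, smul_eq_mul, Finset.mul_sum]
  rw [Finset.sum_comm]
  exact Finset.sum_congr rfl fun i _ => Finset.sum_congr rfl fun j _ => by ring

theorem zeroNorm_eq_sum {ν : ℕ} {x : Fin ν → ℝ} (hx : ∀ j, x j = 0 ∨ x j = 1) :
    zeroNorm x = ∑ j, x j := by
  rw [zeroNorm, Finset.card_filter]
  push_cast
  refine Finset.sum_congr rfl fun j _ => ?_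
  rcases hx j with h | h <;> simp [h]

/-- The cost of a binary vector lies between the extreme costs times its number of nonzeros. -/
theorem dot_bounds {ν : ℕ} {c x : Fin ν → ℝ} {m M : ℝ} (hx : ∀ j, x j = 0 ∨ x j = 1)
    (hc : ∀ j, m ≤ c j ∧ c j ≤ M) :
    m * zeroNorm x ≤ dot c x ∧ dot c x ≤ M * zeroNorm x := by
  rw [zeroNorm_eq_sum hx, Finset.mul_sum, Finset.mul_sum, dot]
  have hx0 : ∀ j, 0 ≤ x j := fun j => by rcases hx j with h | h <;> simp [h]
  exact ⟨Finset.sum_le_sum fun j _ => mul_le_mul_of_nonneg_right (hc j).1 (hx0 j),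
    Finset.sum_le_sum fun j _ => mul_le_mul_of_nonneg_right (hc j).2 (hx0 j)⟩

theorem convComb_mono {ν : ℕ} {X : Set (Fin ν → ℝ)} (hX : X.Nonempty) {k l : ℕ} (hkl : k ≤ l) :
    convComb X k ⊆ convComb X l := by
  obtain ⟨d, rfl⟩ := Nat.exists_eq_add_of_le hkl
  obtain ⟨x₀, hx₀⟩ := hX
  rintro x ⟨xs, lam, hxs, hlam, hsum, rfl⟩
  refine ⟨Fin.append xs fun _ => x₀, Fin.append lam fun _ => 0, ?_, ?_, ?_, ?_⟩
  · exact fun i => Fin.addCases (fun i => by simpa using hxs i) (fun i => by simpa using hx₀) i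
  · exact fun i => Fin.addCases (fun i => by simpa using hlam i) (fun i => by simp) i
  · simpa [Fin.sum_univ_add] using hsum
  · simp [Fin.sum_univ_add]

theorem convComb_nonempty {ν : ℕ} {X : Set (Fin ν → ℝ)} (hX : X.Nonempty) {k : ℕ} (hk : 1 ≤ k) :
    (convComb X k).Nonempty := by
  obtain ⟨x₀, hx₀⟩ := hX
  exact ⟨x₀, convComb_mono ⟨x₀, hx₀⟩ hk
    ⟨fun _ => x₀, fun _ => 1, fun _ => hx₀, fun _ => zero_le_one, by simp, by simp⟩⟩

/-- Allowing more points in the convex combinations does not increase the optimal value, provided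
all costs are nonnegative. -/
theorem optVal_anti {ν : ℕ} {X U : Set (Fin ν → ℝ)} (hX : X.Nonempty)
    (h0 : ∀ c ∈ U, ∀ x ∈ X, 0 ≤ dot c x) {k l : ℕ} (hk : 1 ≤ k) (hkl : k ≤ l) :
    optVal X U l ≤ optVal X U k := by
  refine csInf_le_csInf ⟨0, ?_⟩ ((convComb_nonempty hX hk).image _)
    (Set.image_mono (convComb_mono hX hkl))
  rintro _ ⟨_, ⟨xs, lam, hxs, hlam, -, rfl⟩, rfl⟩
  refine Real.sSup_nonneg ?_
  rintro _ ⟨c, hc, rfl⟩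
  simp only [dot_sum_smul]
  exact Finset.sum_nonneg fun i _ => mul_nonneg (hlam i) (h0 c hc _ (hxs i))

theorem dot_le_objSup {ν : ℕ} {U : Set (Fin ν → ℝ)} (hU : IsCompact U) {c : Fin ν → ℝ}
    (hc : c ∈ U) (x : Fin ν → ℝ) : dot c x ≤ objSup U x := by
  have hcont : Continuous fun c => dot c x := by unfold dot; fun_prop
  exact le_csSup (hU.image hcont).bddAbove ⟨c, hc, rfl⟩

/-- In a nonincreasing sequence of weights of total one, every weight from position `k` on
(counting from zero) is at most `1 / (k + 1)`. -/
theorem weight_mul_le_one {n : ℕ} {lam : Fin n → ℝ} (h0 : ∀ i, 0 ≤ lam i)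
    (hsum : ∑ i, lam i = 1) (hsort : Antitone lam) {k : ℕ} {i : Fin n} (hki : k ≤ i) :
    lam i * ((k : ℝ) + 1) ≤ 1 := by
  calc lam i * ((k : ℝ) + 1) ≤ lam i * ((i : ℕ) + 1 : ℝ) := by
        have := h0 i
        gcongr
    _ = ∑ _j ∈ Finset.Iic i, lam i := by
        rw [Finset.sum_const, Fin.card_Iic, nsmul_eq_mul]; push_cast; ring
    _ ≤ ∑ j ∈ Finset.Iic i, lam j :=
        Finset.sum_le_sum fun j hj => hsort (Finset.mem_Iic.1 hj)
    _ ≤ ∑ j, lam j := Finset.sum_le_univ_sum_of_nonneg h0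
    _ = 1 := hsum

theorem sum_tail_const {n k : ℕ} (hkn : k ≤ n) (B : ℝ) :
    ∑ i : Fin n, (if (i : ℕ) < k then 0 else B) = ((n : ℝ) - k) * B := by
  obtain ⟨d, rfl⟩ := Nat.exists_eq_add_of_le hkn
  simp [Fin.sum_univ_add]

/-- Assume `p > 0`. For `1 ≤ k ≤ k' ≤ n`,
`app(k) ≤ (1 + M̃·(n−k)/(k+1))·opt(k')` with `M̃ = (M_∞/m_∞)·(p̄/p)`. -/
theorem stmt10 (n : ℕ) (hn : 0 < n)
    (X : Set (Fin n → ℝ)) (hXfin : X.Finite) (hXne : X.Nonempty)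
    (hXbin : ∀ x ∈ X, ∀ j, x j = 0 ∨ x j = 1)
    (U : Set (Fin n → ℝ)) (hUne : U.Nonempty) (hUcomp : IsCompact U) (hUconv : Convex ℝ U)
    (m_inf M_inf : ℝ) (hm : 0 < m_inf) (hmM : m_inf ≤ M_inf)
    (hc : ∀ c ∈ U, ∀ j, m_inf ≤ c j ∧ c j ≤ M_inf)
    (p pbar : ℝ) (hp0 : 0 ≤ p) (hppbar : p ≤ pbar)
    (hpx : ∀ x ∈ X, p ≤ zeroNorm x ∧ zeroNorm x ≤ pbar)
    (xs : Fin n → (Fin n → ℝ)) (lam : Fin n → ℝ)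
    (hxs : ∀ i, xs i ∈ X) (hlam0 : ∀ i, 0 ≤ lam i) (hlamsum : (∑ i, lam i) = 1)
    (hlamsort : ∀ i j : Fin n, i ≤ j → lam j ≤ lam i)
    (hopt : objSup U (∑ i, lam i • xs i) = optVal X U n)
    (hppos : 0 < p)
    (k k' : ℕ) (hk : 1 ≤ k) (hkk' : k ≤ k') (hk'n : k' ≤ n) :
    appVal U xs k ≤
      (1 + (M_inf / m_inf) * (pbar / p) * (((n : ℝ) - k) / ((k : ℝ) + 1))) * optVal X U k' := by
  have hMtop : 0 ≤ M_inf := hm.le.trans hmM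
  have hlo : ∀ c ∈ U, ∀ x ∈ X, m_inf * p ≤ dot c x := fun c hcU x hx =>
    (mul_le_mul_of_nonneg_left (hpx x hx).1 hm.le).trans (dot_bounds (hXbin x hx) (hc c hcU)).1
  have hup : ∀ c ∈ U, ∀ x ∈ X, dot c x ≤ M_inf * pbar := fun c hcU x hx =>
    (dot_bounds (hXbin x hx) (hc c hcU)).2.trans (mul_le_mul_of_nonneg_left (hpx x hx).2 hMtop)
  have hmp : 0 < m_inf * p := mul_pos hm hppos
  have hMp : 0 ≤ M_inf * pbar := mul_nonneg hMtop (hp0.trans hppbar)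
  have hnonneg : ∀ c ∈ U, ∀ x ∈ X, 0 ≤ dot c x := fun c hcU x hx => hmp.le.trans (hlo c hcU x hx)
  have hkn : k ≤ n := hkk'.trans hk'n
  have hoptle : ∀ c ∈ U, ∑ i, lam i * dot c (xs i) ≤ optVal X U k' := fun c hcU => by
    rw [← dot_sum_smul]
    exact ((dot_le_objSup hUcomp hcU _).trans_eq hopt).trans
      (optVal_anti hXne hnonneg (hk.trans hkk') hk'n)
  have hoptlo : m_inf * p ≤ optVal X U k' := by
    obtain ⟨c, hcU⟩ := hUne
    refine le_trans ?_ (hoptle c hcU)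
    calc m_inf * p = ∑ i, lam i * (m_inf * p) := by rw [← Finset.sum_mul, hlamsum, one_mul]
      _ ≤ _ := Finset.sum_le_sum fun i _ =>
        mul_le_mul_of_nonneg_left (hlo c hcU _ (hxs i)) (hlam0 i)
  refine csSup_le (hUne.image _) ?_
  rintro _ ⟨c, hcU, rfl⟩
  set v := ⨅ i : {i : Fin n // (i : ℕ) < k}, dot c (xs i.1) with hv
  have hvle : ∀ i : Fin n, (i : ℕ) < k → v ≤ dot c (xs i) := fun i hi =>
    ciInf_le (Set.finite_range fun i : {i : Fin n // (i : ℕ) < k} => dot c (xs i.1)).bddBelow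
      ⟨i, hi⟩
  have hvup : v ≤ M_inf * pbar :=
    (hvle ⟨0, hn⟩ (Nat.lt_of_lt_of_le Nat.zero_lt_one hk)).trans (hup c hcU _ (hxs _))
  have hk1 : (0 : ℝ) < (k : ℝ) + 1 := by positivity
  have hterm : ∀ i : Fin n, lam i * v ≤
      lam i * dot c (xs i) + if (i : ℕ) < k then 0 else M_inf * pbar / ((k : ℝ) + 1) := by
    intro i
    split_ifs with hi
    · simpa using mul_le_mul_of_nonneg_left (hvle i hi) (hlam0 i)
    · have hw : lam i ≤ 1 / ((k : ℝ) + 1) := (le_div_iff₀ hk1).2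
        (weight_mul_le_one hlam0 hlamsum (fun i j => hlamsort i j) (not_lt.1 hi))
      calc lam i * v ≤ lam i * (M_inf * pbar) := mul_le_mul_of_nonneg_left hvup (hlam0 i)
        _ ≤ 1 / ((k : ℝ) + 1) * (M_inf * pbar) := mul_le_mul_of_nonneg_right hw hMp
        _ = M_inf * pbar / ((k : ℝ) + 1) := by ring
        _ ≤ _ := le_add_of_nonneg_left (mul_nonneg (hlam0 i) (hnonneg c hcU _ (hxs i)))
  have hkn' : (0 : ℝ) ≤ ((n : ℝ) - k) / ((k : ℝ) + 1) :=
    div_nonneg (sub_nonneg.2 (by exact_mod_cast hkn)) hk1.le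
  calc v = ∑ i, lam i * v := by rw [← Finset.sum_mul, hlamsum, one_mul]
    _ ≤ ∑ i, lam i * dot c (xs i) + ((n : ℝ) - k) * (M_inf * pbar / ((k : ℝ) + 1)) := by
      rw [← sum_tail_const hkn, ← Finset.sum_add_distrib]
      exact Finset.sum_le_sum fun i _ => hterm i
    _ = ∑ i, lam i * dot c (xs i) +
        (M_inf / m_inf) * (pbar / p) * (((n : ℝ) - k) / ((k : ℝ) + 1)) * (m_inf * p) := by
      field_simp
    _ ≤ optVal X U k' +
        (M_inf / m_inf) * (pbar / p) * (((n : ℝ) - k) / ((k : ℝ) + 1)) * optVal X U k' := by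
      refine add_le_add (hoptle c hcU) (mul_le_mul_of_nonneg_left hoptlo (mul_nonneg ?_ hkn'))
      exact mul_nonneg (div_nonneg hMtop hm.le) (div_nonneg (hp0.trans hppbar) hp0)
    _ = _ := by ring
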